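/- arXiv:1606.01973 — 2 statements merged into one kernel-verified Lean document; each statement's English description precedes it below -/
import Mathlib

section
/- Let K = inf{ 16x² / (1 − x + x·ln x) : x ∈ ℝ, x > 1 } (K ≈ 98.8249). For every ε > 0 there exists n_ε ∈ ℕ such that for every n ≥ n_ε there is a finite simple graph G with fewer than (K+ε)·n⁴·ln n vertices such that G → T for every oriented tree T on n vertices. -/
/-- An orientation of a simple graph `G`: an asymmetric relation `D` whose
symmetrization is exactly the adjacency relation of `G`. -/
def IsOrientation {V : Type*} (G : SimpleGraph V) (D : V → V → Prop) : Prop :=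
  (∀ u v, ¬ (D u v ∧ D v u)) ∧ ∀ u v, G.Adj u v ↔ (D u v ∨ D v u)

/-- A digraph structure on a relation: no loops and no pairs of opposite arcs. -/
def IsDigraph {W : Type*} (E : W → W → Prop) : Prop :=
  ∀ u v, ¬ (E u v ∧ E v u)

/-- `G ⇒ E`: every orientation `D` of `G` contains an isometric copy of the digraph `E`:
an injective map `f` inducing an isomorphism onto its image, preserving orientations,
such that distances (in the underlying undirected graphs) are preserved. -/
def IsoRamseyArrow {V W : Type*} (G : SimpleGraph V) (E : W → W → Prop) : Prop :=
  ∀ D : V → V → Prop, IsOrientation G D →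
    ∃ f : W → V, Function.Injective f ∧
      (∀ u v, E u v ↔ D (f u) (f v)) ∧
      (∀ u v, (SimpleGraph.fromRel E).edist u v = G.edist (f u) (f v))

/-- An oriented tree: a digraph whose underlying undirected graph is a tree. -/
def IsOrientedTree {W : Type*} (E : W → W → Prop) : Prop :=
  IsDigraph E ∧ (SimpleGraph.fromRel E).IsTree

/-- `G → E`: every orientation `D` of `G` contains an induced, orientation-preserving
copy of the digraph `E` (no distance requirement). -/
def RamseyArrow {V W : Type*} (G : SimpleGraph V) (E : W → W → Prop) : Prop :=
  ∀ D : V → V → Prop, IsOrientation G D →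
    ∃ f : W → V, Function.Injective f ∧ (∀ u v, E u v ↔ D (f u) (f v))

/-- `G → 𝒯ₙ` : `G → T` for every oriented tree `T` on `n` vertices. -/
def RamseyArrowTrees {V : Type*} (G : SimpleGraph V) (n : ℕ) : Prop :=
  ∀ (W : Type) (_ : Fintype W), Fintype.card W = n →
    ∀ E : W → W → Prop, IsOrientedTree E → RamseyArrow G E


namespace Aux12
open Finset
open scoped Classical

noncomputable def eds {V : Type} (S : Finset V) : Finset (Sym2 V) :=
  S.offDiag.image (Function.uncurry Sym2.mk)

lemma flip_or {V : Type} {G : SimpleGraph V} {D : V → V → Prop} (h : IsOrientation G D) :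
    IsOrientation G (fun a b => D b a) :=
  ⟨fun u v hh => h.1 u v ⟨hh.2, hh.1⟩, fun u v => by rw [h.2 u v]; tauto⟩

lemma sparse_small {V : Type} [Fintype V] (G : SimpleGraph V) (R : V → V → Prop)
    (hR : IsOrientation G R) (d : ℝ) (t : ℕ)
    (hsp : ∀ S : Finset V, t < #S → d * #S ≤ #{e ∈ eds S | e ∈ G.edgeSet}) (A : Finset V) :
    #{a ∈ A | (#{b ∈ A | R a b} : ℝ) < d} ≤ t := by
  by_contra! hlt
  set B := {a ∈ A | (#{b ∈ A | R a b} : ℝ) < d} with hB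
  have h1 := hsp B hlt
  have h2 : #{e ∈ eds B | e ∈ G.edgeSet} ≤ #(B.sigma (fun a => {b ∈ A | R a b})) := by
    apply Finset.card_le_card_of_surjOn (fun x => s(x.1, x.2))
    intro e he
    simp only [coe_filter, Set.mem_ofPred_eq, eds, mem_image, mem_offDiag] at he
    obtain ⟨⟨⟨a, b⟩, ⟨ha, hb, hab⟩, rfl⟩, hadj⟩ := he
    simp only [Function.uncurry, SimpleGraph.mem_edgeSet] at hadj
    have hBA : ∀ z ∈ B, z ∈ A := fun z hz => (mem_filter.1 hz).1
    rcases (hR.2 a b).1 hadj with h | h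
    · refine ⟨⟨a, b⟩, ?_, rfl⟩
      simp only [coe_sigma, Set.mem_sigma_iff, mem_coe, mem_filter]
      exact ⟨ha, hBA _ hb, h⟩
    · refine ⟨⟨b, a⟩, ?_, Sym2.eq_swap⟩
      simp only [coe_sigma, Set.mem_sigma_iff, mem_coe, mem_filter]
      exact ⟨hb, hBA _ ha, h⟩
  rw [card_sigma] at h2
  have h3 : ((∑ a ∈ B, #{b ∈ A | R a b} : ℕ) : ℝ) < ∑ a ∈ B, d := by
    push_cast
    apply sum_lt_sum_of_nonempty
    · exact card_pos.1 (by omega)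
    · intro a ha
      exact (mem_filter.1 ha).2
  rw [sum_const, nsmul_eq_mul] at h3
  have h4 : ((#{e ∈ eds B | e ∈ G.edgeSet} : ℕ) : ℝ) ≤ ((∑ a ∈ B, #{b ∈ A | R a b} : ℕ) : ℝ) := by
    exact_mod_cast h2
  linarith

lemma extend {V W : Type} [Fintype V] [Fintype W] (G : SimpleGraph V) (R : V → V → Prop)
    (hR : IsOrientation G R) (A A0 : Finset V) (c d : ℝ) (hc : 0 ≤ c)
    (hcod : ∀ u ∈ A0, ∀ v ∈ A0, u ≠ v → (#{w : V | G.Adj u w ∧ G.Adj v w} : ℝ) ≤ c)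
    (f : W → V) (hf : Function.Injective f) (hfA : ∀ w, f w ∈ A0) (u : W)
    (hu : d ≤ #{b ∈ A | R (f u) b}) (hd : (Fintype.card W : ℝ) * (c + 1) < d) :
    ∃ y ∈ A, R (f u) y ∧ (∀ w, f w ≠ y) ∧ ∀ w, w ≠ u → ¬ G.Adj (f w) y := by
  by_contra! hcon
  have hsub : {b ∈ A | R (f u) b} ⊆ (univ : Finset W).biUnion (fun w =>
      if w = u then {f w} else insert (f w) ({z : V | G.Adj (f u) z ∧ G.Adj (f w) z} : Finset V)) := by
    intro y hy
    rw [mem_filter] at hy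
    rw [mem_biUnion]
    by_cases h : ∀ w, f w ≠ y
    · obtain ⟨w, hw, hadj⟩ := hcon y hy.1 hy.2 h
      refine ⟨w, mem_univ _, ?_⟩
      rw [if_neg hw]
      simp only [mem_insert, mem_filter, mem_univ, true_and]
      exact Or.inr ⟨(hR.2 _ _).2 (Or.inl hy.2), hadj⟩
    · push Not at h
      obtain ⟨w, hw⟩ := h
      refine ⟨w, mem_univ _, ?_⟩
      split_ifs <;> simp [hw]
  have h1 := (card_le_card hsub).trans card_biUnion_le
  have h2 : ((∑ w : W, #(if w = u then {f w} else insert (f w) ({z : V | G.Adj (f u) z ∧ G.Adj (f w) z} : Finset V)) : ℕ) : ℝ)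
      ≤ ∑ w : W, (c + 1) := by
    push_cast
    apply sum_le_sum
    intro w _
    split_ifs with h
    · simp [hc]
    · have h3 := hcod (f u) (hfA u) (f w) (hfA w) (fun hh => h (hf hh).symm)
      have h4 := card_insert_le (f w) ({z : V | G.Adj (f u) z ∧ G.Adj (f w) z} : Finset V)
      have h5 : ((#(insert (f w) ({z : V | G.Adj (f u) z ∧ G.Adj (f w) z} : Finset V)) : ℕ) : ℝ) ≤
        (#({z : V | G.Adj (f u) z ∧ G.Adj (f w) z} : Finset V) : ℝ) + 1 := by exact_mod_cast h4
      linarith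
  rw [sum_const, nsmul_eq_mul, card_univ] at h2
  have h6 : ((#{b ∈ A | R (f u) b} : ℕ) : ℝ) ≤ _ := Nat.cast_le.2 h1
  linarith

lemma embed {V : Type} [Fintype V] (G : SimpleGraph V) (D : V → V → Prop)
    (hD : IsOrientation G D) (A0 : Finset V) (c d : ℝ) (hc : 0 ≤ c) (n t : ℕ)
    (hcod : ∀ u ∈ A0, ∀ v ∈ A0, u ≠ v → (#{w : V | G.Adj u w ∧ G.Adj v w} : ℝ) ≤ c)
    (hd : (n : ℝ) * (c + 1) ≤ d)
    (hsp : ∀ S : Finset V, t < #S → d * #S ≤ #{e ∈ eds S | e ∈ G.edgeSet}) :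
    ∀ m : ℕ, m + 1 ≤ n → ∀ (W : Type) (_ : Fintype W), Fintype.card W = m + 1 →
      ∀ E : W → W → Prop, IsOrientedTree E → ∀ A ⊆ A0, m * t < #A →
      ∃ f : W → V, Function.Injective f ∧ (∀ w, f w ∈ A) ∧ ∀ u v, E u v ↔ D (f u) (f v) := by
  intro m
  induction m with
  | zero =>
    intro _ W _ hW E hE A _ hA
    obtain ⟨a, ha⟩ := card_pos.1 (by omega : 0 < #A)
    have : Subsingleton W := Fintype.card_le_one_iff_subsingleton.1 (by omega)
    refine ⟨fun _ => a, Function.injective_of_subsingleton _, fun _ => ha, fun u v => ?_⟩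
    obtain rfl := Subsingleton.elim u v
    exact ⟨fun h => absurd ⟨h, h⟩ (hE.1 u u), fun h => absurd ⟨h, h⟩ (hD.1 a a)⟩
  | succ m ih =>
    intro hm W _ hW E hE A hA hAc
    have : Nontrivial W := Fintype.one_lt_card_iff_nontrivial.1 (by omega)
    obtain ⟨v, hv⟩ := hE.2.exists_vert_degree_one_of_nontrivial
    have hconn := hE.2.1.induce_compl_singleton_of_degree_eq_one hv
    have hacyc := hE.2.2.induce ({v}ᶜ : Set W)
    obtain ⟨u, huv, huniq⟩ := SimpleGraph.degree_eq_one_iff_existsUnique_adj.1 hv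
    have hvu : u ≠ v := huv.ne'
    have huniq' : ∀ w, w ≠ u → ¬ E v w ∧ ¬ E w v := by
      intro w hw
      by_cases hwv : w = v
      · subst hwv
        exact ⟨fun h => hE.1 _ _ ⟨h, h⟩, fun h => hE.1 _ _ ⟨h, h⟩⟩
      · have := mt (huniq w) hw
        simp only [SimpleGraph.fromRel_adj, not_and, not_or] at this
        exact this (Ne.symm hwv)
    let E' : {w : W // w ≠ v} → {w : W // w ≠ v} → Prop := fun a b => E a b
    have hE' : IsOrientedTree E' := by
      refine ⟨fun a b => hE.1 a b, ?_⟩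
      have heq : SimpleGraph.fromRel E' = (SimpleGraph.fromRel E).induce ({v}ᶜ : Set W) := by
        ext a b
        change _ ↔ (SimpleGraph.fromRel E).Adj a.1 b.1
        simp [E', SimpleGraph.fromRel_adj, Subtype.ext_iff]
      rw [heq]
      exact ⟨hconn, hacyc⟩
    have hcard : Fintype.card {w : W // w ≠ v} = m + 1 := by
      rw [Fintype.card_subtype_compl, Fintype.card_subtype_eq, hW]; rfl
    have key : ∀ R : V → V → Prop, IsOrientation G R →
        ∃ f : {w : W // w ≠ v} → V, Function.Injective f ∧ (∀ w, f w ∈ A) ∧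
          (∀ a b, E' a b ↔ D (f a) (f b)) ∧
          ∃ y ∈ A, R (f ⟨u, hvu⟩) y ∧ (∀ w, f w ≠ y) ∧
            ∀ w, w ≠ ⟨u, hvu⟩ → ¬ G.Adj (f w) y := by
      intro R hR
      have hB := sparse_small G R hR d t hsp A
      set B := {a ∈ A | (#{b ∈ A | R a b} : ℝ) < d} with hBdef
      have hBA : B ⊆ A := filter_subset _ _
      obtain ⟨f, hf, hfA, hfE⟩ := ih (by omega) {w : W // w ≠ v} inferInstance hcard E' hE' (A \ B)
        (sdiff_subset.trans hA) (by
          rw [card_sdiff_of_subset hBA]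
          have : (m + 1) * t = m * t + t := by ring
          omega)
      refine ⟨f, hf, fun w => (mem_sdiff.1 (hfA w)).1, hfE, ?_⟩
      refine extend G R hR A A0 c d hc hcod f hf (fun w => hA (mem_sdiff.1 (hfA w)).1) ⟨u, hvu⟩ ?_ ?_
      · have h := mem_sdiff.1 (hfA ⟨u, hvu⟩)
        by_contra! hlt
        exact h.2 (mem_filter.2 ⟨h.1, hlt⟩)
      · rw [hcard]
        have : ((m : ℝ) + 1) + 1 ≤ n := by exact_mod_cast hm
        push_cast
        nlinarith
    have fin : ∀ (f : {w : W // w ≠ v} → V), Function.Injective f → (∀ w, f w ∈ A) →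
        (∀ a b, E' a b ↔ D (f a) (f b)) → ∀ y ∈ A, (E u v ↔ D (f ⟨u, hvu⟩) y) →
        (E v u ↔ D y (f ⟨u, hvu⟩)) → (∀ w, f w ≠ y) →
        (∀ w, w ≠ ⟨u, hvu⟩ → ¬ G.Adj (f w) y) →
        ∃ f : W → V, Function.Injective f ∧ (∀ w, f w ∈ A) ∧ ∀ u v, E u v ↔ D (f u) (f v) := by
      intro f hf hfA hfE y hy h1 h2 h3 h4
      have h5 : ∀ w, w ≠ ⟨u, hvu⟩ → ¬ D (f w) y ∧ ¬ D y (f w) := by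
        intro w hw
        have := h4 w hw
        rw [hD.2] at this
        tauto
      refine ⟨fun w => if h : w = v then y else f ⟨w, h⟩, ?_, ?_, ?_⟩
      · intro a b hab
        by_cases ha : a = v <;> by_cases hb : b = v
        · rw [ha, hb]
        · simp only [ha, hb, dite_true, dite_false] at hab
          exact absurd hab.symm (h3 _)
        · simp only [ha, hb, dite_true, dite_false] at hab
          exact absurd hab (h3 _)
        · simp only [ha, hb, dite_false] at hab
          exact congrArg Subtype.val (hf hab)
      · intro w
        by_cases h : w = v <;> simp [h, hy, hfA]
      · intro a b
        by_cases ha : a = v <;> by_cases hb : b = v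
        · subst ha; subst hb
          simp only [dite_true]
          exact ⟨fun h => absurd ⟨h, h⟩ (hE.1 _ _), fun h => absurd ⟨h, h⟩ (hD.1 _ _)⟩
        · simp only [ha, hb, dite_true, dite_false]
          by_cases hbu : b = u
          · subst hbu; exact h2
          · exact ⟨fun h => absurd h (huniq' b hbu).1,
              fun h => absurd h (h5 ⟨b, hb⟩ (fun hh => hbu (congrArg Subtype.val hh))).2⟩
        · simp only [ha, hb, dite_true, dite_false]
          by_cases hau : a = u
          · subst hau; exact h1
          · exact ⟨fun h => absurd h (huniq' a hau).2,
              fun h => absurd h (h5 ⟨a, ha⟩ (fun hh => hau (congrArg Subtype.val hh))).1⟩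
        · simp only [ha, hb, dite_false]
          exact hfE ⟨a, ha⟩ ⟨b, hb⟩
    have hor : E v u ∨ E u v := by
      have := huv
      simp only [SimpleGraph.fromRel_adj] at this
      exact this.2
    rcases hor with h | h
    · obtain ⟨f, hf, hfA, hfE, y, hy, hRy, h3, h4⟩ := key _ (flip_or hD)
      exact fin f hf hfA hfE y hy
        ⟨fun h' => absurd ⟨h, h'⟩ (hE.1 _ _), fun h' => absurd ⟨h', hRy⟩ (hD.1 _ _)⟩
        ⟨fun _ => hRy, fun _ => h⟩ h3 h4
    · obtain ⟨f, hf, hfA, hfE, y, hy, hRy, h3, h4⟩ := key _ hD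
      exact fin f hf hfA hfE y hy ⟨fun _ => hRy, fun _ => h⟩
        ⟨fun h' => absurd ⟨h, h'⟩ (hE.1 _ _), fun h' => absurd ⟨h', hRy⟩ (hD.1 _ _)⟩ h3 h4

noncomputable def Gr {V : Type} (ω : Finset (Sym2 V)) : SimpleGraph V :=
  SimpleGraph.fromEdgeSet (ω : Set (Sym2 V))

lemma Gr_adj {V : Type} (ω : Finset (Sym2 V)) (a b : V) :
    (Gr ω).Adj a b ↔ s(a, b) ∈ ω ∧ a ≠ b := by
  simp [Gr]

noncomputable def wt {ι : Type} [Fintype ι] (p : ℝ) (ω : Finset ι) : ℝ :=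
  p ^ #ω * (1 - p) ^ #(univ \ ω)

lemma wt_nonneg {ι : Type} [Fintype ι] {p : ℝ} (h0 : 0 ≤ p) (h1 : p ≤ 1) (ω : Finset ι) :
    0 ≤ wt p ω := mul_nonneg (pow_nonneg h0 _) (pow_nonneg (by linarith) _)

lemma wt_sub {ι : Type} [Fintype ι] (p : ℝ) (S : Finset ι) :
    ∑ ω : Finset ι, wt p ω * (if S ⊆ ω then 1 else 0) = p ^ #S := by
  have h := Finset.prod_add (fun _ : ι => p) (fun e => if e ∈ S then 0 else 1 - p) univ
  have hl : ∏ i : ι, (p + if i ∈ S then 0 else 1 - p) = p ^ #S := by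
    rw [← prod_const, ← prod_filter_mul_prod_filter_not univ (fun i => i ∈ S)]
    rw [prod_congr rfl (g := fun _ => p), prod_congr (s₁ := {i | ¬ i ∈ S}) rfl (g := fun _ => (1:ℝ))]
    · simp
    · intro i hi; simp [(mem_filter.1 hi).2]
    · intro i hi; simp [(mem_filter.1 hi).2]
  rw [hl] at h
  rw [h, powerset_univ]
  apply sum_congr rfl
  intro ω _
  rw [wt, prod_const, mul_assoc]
  congr 1
  split_ifs with hS
  · rw [mul_one, ← prod_const]
    apply prod_congr rfl
    intro i hi
    rw [if_neg]
    intro hiS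
    exact (mem_sdiff.1 hi).2 (hS hiS)
  · rw [mul_zero]
    obtain ⟨i, hi, hi'⟩ := not_subset.1 hS
    symm
    exact prod_eq_zero (i := i) (by simp [hi']) (by simp [hi])

lemma wt_sum {ι : Type} [Fintype ι] (p : ℝ) : ∑ ω : Finset ι, wt p ω = 1 := by
  simpa using wt_sub p (∅ : Finset ι)

lemma mgf {ι κ : Type} [Fintype ι] (p a : ℝ) (K : Finset κ) (F : κ → Finset ι) (r : ℕ)
    (hF : ∀ k ∈ K, #(F k) = r) (hdis : ∀ k ∈ K, ∀ l ∈ K, k ≠ l → Disjoint (F k) (F l)) :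
    ∑ ω : Finset ι, wt p ω * a ^ #{k ∈ K | F k ⊆ ω} = (1 + (a - 1) * p ^ r) ^ #K := by
  have h1 : ∀ ω : Finset ι, a ^ #{k ∈ K | F k ⊆ ω} =
      ∑ T ∈ K.powerset, (a - 1) ^ #T * (if T.biUnion F ⊆ ω then 1 else 0) := by
    intro ω
    have : a ^ #{k ∈ K | F k ⊆ ω} = ∏ k ∈ K, (1 + (a - 1) * (if F k ⊆ ω then 1 else 0)) := by
      rw [← prod_const, prod_filter]
      apply prod_congr rfl
      intro k _
      split_ifs <;> ring
    rw [this, prod_one_add]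
    apply sum_congr rfl
    intro T _
    rw [prod_mul_distrib, prod_const]
    congr 1
    rw [prod_ite_zero]
    simp
  simp_rw [h1, mul_sum]
  rw [sum_comm, ← prod_const, prod_one_add]
  apply sum_congr rfl
  intro T hT
  have hT' := mem_powerset.1 hT
  have h2 : #(T.biUnion F) = r * #T := by
    rw [card_biUnion (fun k hk l hl hkl => hdis k (hT' hk) l (hT' hl) hkl),
      sum_congr rfl (fun k hk => hF k (hT' hk))]
    simp [mul_comm]
  rw [prod_const, mul_pow, ← pow_mul, ← h2, ← wt_sub p, mul_sum]
  apply sum_congr rfl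
  intros; ring

lemma chernoff {ι κ : Type} [Fintype ι] (p a : ℝ) (h0 : 0 ≤ p) (h1 : p ≤ 1) (ha : 0 < a)
    (K : Finset κ) (F : κ → Finset ι) (r : ℕ)
    (hF : ∀ k ∈ K, #(F k) = r) (hdis : ∀ k ∈ K, ∀ l ∈ K, k ≠ l → Disjoint (F k) (F l))
    (P : Finset ι → Prop) [DecidablePred P]
    (hP : ∀ ω, P ω → 0 ≤ (a - 1) * ((#{k ∈ K | F k ⊆ ω} : ℝ) - a * p ^ r * #K)) :
    ∑ ω : Finset ι, wt p ω * (if P ω then 1 else 0) ≤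
      Real.exp (- (p ^ r * #K * (1 - a + a * Real.log a))) := by
  have hb : ∀ ω, (if P ω then (1:ℝ) else 0) ≤
      a ^ #{k ∈ K | F k ⊆ ω} * Real.exp (- (Real.log a * (a * p ^ r * #K))) := by
    intro ω
    have : a ^ #{k ∈ K | F k ⊆ ω} = Real.exp (Real.log a * #{k ∈ K | F k ⊆ ω}) := by
      rw [mul_comm, Real.exp_nat_mul, Real.exp_log ha]
    rw [this, ← Real.exp_add]
    split_ifs with h
    · apply Real.one_le_exp
      have h2 := hP ω h
      have h3 : Real.log a * #{k ∈ K | F k ⊆ ω} + - (Real.log a * (a * p ^ r * #K)) =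
        Real.log a * ((#{k ∈ K | F k ⊆ ω} : ℝ) - a * p ^ r * #K) := by ring
      rw [h3]
      rcases lt_trichotomy a 1 with h4 | h4 | h4
      · exact mul_nonneg_of_nonpos_of_nonpos (Real.log_nonpos ha.le h4.le) (by nlinarith)
      · simp [h4]
      · exact mul_nonneg (Real.log_nonneg h4.le) (by nlinarith)
    · positivity
  calc _ ≤ ∑ ω : Finset ι, wt p ω * (a ^ #{k ∈ K | F k ⊆ ω} * Real.exp (- (Real.log a * (a * p ^ r * #K)))) :=
        sum_le_sum (fun ω _ => mul_le_mul_of_nonneg_left (hb ω) (wt_nonneg h0 h1 ω))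
    _ = (1 + (a - 1) * p ^ r) ^ #K * Real.exp (- (Real.log a * (a * p ^ r * #K))) := by
        rw [← mgf p a K F r hF hdis, sum_mul]
        apply sum_congr rfl
        intros; ring
    _ ≤ Real.exp ((a - 1) * p ^ r) ^ #K * Real.exp (- (Real.log a * (a * p ^ r * #K))) := by
        have h5 : p ^ r ≤ 1 := pow_le_one₀ h0 h1
        have h6 : 0 ≤ p ^ r := pow_nonneg h0 r
        gcongr
        · nlinarith
        · linarith [Real.add_one_le_exp ((a - 1) * p ^ r)]
    _ = _ := by
        rw [← Real.exp_nat_mul, ← Real.exp_add]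
        congr 1
        ring

lemma codeg_bad {V : Type} [Fintype V] (p x : ℝ) (h0 : 0 ≤ p) (h1 : p ≤ 1) (hx : 1 < x)
    (hL : 0 ≤ 1 - x + x * Real.log x) (u v : V) (huv : u ≠ v) :
    ∑ ω : Finset (Sym2 V), wt p ω * (if x * p ^ 2 * Fintype.card V <
      #{w : V | (Gr ω).Adj u w ∧
        (Gr ω).Adj v w} then 1 else 0) ≤
      Real.exp (- (p ^ 2 * ((Fintype.card V : ℝ) - 2) * (1 - x + x * Real.log x))) := by
  have hcard : (#(univ \ {u, v} : Finset V) : ℝ) = (Fintype.card V : ℝ) - 2 := by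
    rw [card_sdiff_of_subset (subset_univ _), card_pair huv, card_univ, Nat.cast_sub]
    · simp
    · rw [← card_pair huv]; exact card_le_univ _
  rw [← hcard]
  apply chernoff p x h0 h1 (by linarith) (univ \ {u, v} : Finset V)
    (fun w => {s(u, w), s(v, w)}) 2
  · intro w hw
    apply card_pair
    simp only [mem_sdiff, mem_insert, mem_singleton, mem_univ, true_and, not_or] at hw
    simp [huv, Ne.symm hw.1]
  · intro w hw z hz hwz
    simp only [mem_sdiff, mem_insert, mem_singleton, mem_univ, true_and, not_or] at hw hz
    rw [disjoint_left]
    intro e he he'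
    simp only [mem_insert, mem_singleton] at he he'
    rcases he with rfl | rfl <;> simp at he' <;> grind
  · intro ω hω
    have hle : #{w : V | (Gr ω).Adj u w ∧
        (Gr ω).Adj v w} ≤
        #{k ∈ (univ \ {u, v} : Finset V) | ({s(u, k), s(v, k)} : Finset (Sym2 V)) ⊆ ω} := by
      apply card_le_card
      intro w hw
      simp only [mem_filter, mem_univ, true_and, Gr_adj] at hw
      simp only [mem_filter, mem_sdiff, mem_insert, mem_singleton, mem_univ, true_and, not_or,
        insert_subset_iff, singleton_subset_iff]
      exact ⟨⟨Ne.symm hw.1.2, Ne.symm hw.2.2⟩, hw.1.1, hw.2.1⟩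
    have hle' : ((#{w : V | (Gr ω).Adj u w ∧
        (Gr ω).Adj v w} : ℕ) : ℝ) ≤ _ := Nat.cast_le.2 hle
    have h3 : 0 ≤ x * p ^ 2 := by positivity
    apply mul_nonneg (by linarith)
    rw [hcard]
    have h4 : x * p ^ 2 * ((Fintype.card V : ℝ) - 2) ≤ x * p ^ 2 * Fintype.card V :=
      mul_le_mul_of_nonneg_left (by linarith) h3
    refine sub_nonneg.2 ?_
    convert h4.trans (hω.le.trans hle')
    rfl

lemma sparse_bad {V : Type} [Fintype V] (p θ d : ℝ) (t : ℕ) (h0 : 0 ≤ p) (h1 : p ≤ 1) (hθ : 0 < θ)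
    (hθ1 : θ < 1) (hL : 0 ≤ 1 - θ + θ * Real.log θ) (hd : d ≤ θ * p * t / 2) (S : Finset V)
    (hS : t < #S) :
    ∑ ω : Finset (Sym2 V), wt p ω * (if
      ¬ (d * #S ≤ #{e ∈ eds S | e ∈ (Gr ω).edgeSet})
        then 1 else 0) ≤
      Real.exp (- (p * ((t : ℝ) ^ 2 / 2) * (1 - θ + θ * Real.log θ))) := by
  have hc : (#(eds S) : ℝ) = (#S : ℝ) * (#S - 1) / 2 := by
    rw [eds, Sym2.card_image_offDiag, Nat.cast_choose_two]
  have hS' : (t : ℝ) + 1 ≤ #S := by exact_mod_cast hS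
  have ht : (0 : ℝ) ≤ t := Nat.cast_nonneg _
  have hge : (t : ℝ) ^ 2 / 2 ≤ #(eds S) := by rw [hc]; nlinarith
  refine (chernoff p θ h0 h1 hθ (eds S) (fun e => {e}) 1 (fun _ _ => card_singleton _)
    (fun k _ l _ hkl => by simpa using hkl) _ ?_).trans ?_
  · intro ω hω
    have heq : {e ∈ eds S | e ∈ (Gr ω).edgeSet} =
        {k ∈ eds S | ({k} : Finset (Sym2 V)) ⊆ ω} := by
      apply filter_congr
      intro e he
      simp only [eds, mem_image, mem_offDiag] at he
      obtain ⟨⟨a, b⟩, ⟨ha, hb, hab⟩, rfl⟩ := he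
      simp only [Function.uncurry, SimpleGraph.mem_edgeSet, Gr_adj,
        singleton_subset_iff]
      simp at hab
      tauto
    rw [heq] at hω
    push Not at hω
    apply mul_nonneg_of_nonpos_of_nonpos (by linarith)
    rw [hc, pow_one]
    have h2 : d * #S ≤ θ * p * t / 2 * #S := by gcongr
    have h3 : θ * p * t / 2 * #S ≤ θ * p * ((#S : ℝ) * (#S - 1) / 2) := by
      have : θ * p * t / 2 * #S = θ * p * ((#S : ℝ) * t / 2) := by ring
      rw [this]
      gcongr
      linarith
    refine sub_nonpos.2 ?_
    convert hω.le.trans (h2.trans h3)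
  · rw [pow_one]
    apply Real.exp_le_exp.2
    apply neg_le_neg
    gcongr

lemma exists_graph {V : Type} [Fintype V] (p x θ : ℝ) (m t : ℕ) (h0 : 0 ≤ p) (h1 : p ≤ 1)
    (hx : 1 < x) (hLx : 0 ≤ 1 - x + x * Real.log x) (hθ : 0 < θ) (hθ1 : θ < 1)
    (hLθ : 0 ≤ 1 - θ + θ * Real.log θ) (hN : 0 < Fintype.card V)
    (hd : ((m + 1 : ℕ) : ℝ) * (x * p ^ 2 * Fintype.card V + 1) ≤ θ * p * t / 2)
    (ht : (m : ℝ) * t ≤ θ * Fintype.card V)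
    (hA : (Fintype.card V : ℝ) ^ 2 *
      Real.exp (- (p ^ 2 * ((Fintype.card V : ℝ) - 2) * (1 - x + x * Real.log x))) ≤
      (1 - θ) * Fintype.card V / 4)
    (hB : (2 : ℝ) ^ (Fintype.card V) *
      Real.exp (- (p * ((t : ℝ) ^ 2 / 2) * (1 - θ + θ * Real.log θ))) ≤ 1 / 4) :
    ∃ G : SimpleGraph V, RamseyArrowTrees G (m + 1) := by
  set N : ℝ := (Fintype.card V : ℝ) with hNdef
  have hN' : 0 < N := Nat.cast_pos.2 hN
  set d : ℝ := ((m + 1 : ℕ) : ℝ) * (x * p ^ 2 * N + 1) with hddef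
  let c : ℝ := x * p ^ 2 * N
  let P : Finset (Sym2 V) → V × V → Prop := fun ω q =>
    c < #{w : V | (Gr ω).Adj q.1 w ∧ (Gr ω).Adj q.2 w}
  let Q : Finset (Sym2 V) → Finset V → Prop := fun ω S =>
    ¬ (d * #S ≤ #{e ∈ eds S | e ∈ (Gr ω).edgeSet})
  let bad1 : Finset (Sym2 V) → ℝ := fun ω =>
    ∑ q ∈ (univ : Finset V).offDiag, (if P ω q then (1:ℝ) else 0)
  let bad2 : Finset (Sym2 V) → ℝ := fun ω =>
    ∑ S ∈ ({S | t < #S} : Finset (Finset V)), (if Q ω S then (1:ℝ) else 0)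
  have hE1 : ∑ ω, wt p ω * bad1 ω ≤ (1 - θ) * N / 4 := by
    refine le_trans ?_ hA
    simp only [bad1, mul_sum]
    rw [sum_comm]
    calc _ ≤ ∑ q ∈ (univ : Finset V).offDiag, Real.exp (- (p ^ 2 * (N - 2) * (1 - x + x * Real.log x))) := by
          apply sum_le_sum
          intro q hq
          exact codeg_bad p x h0 h1 hx hLx q.1 q.2 (mem_offDiag.1 hq).2.2
      _ ≤ _ := by
          rw [sum_const, nsmul_eq_mul]
          gcongr
          rw [offDiag_card, card_univ]
          have : ((Fintype.card V * Fintype.card V - Fintype.card V : ℕ) : ℝ) ≤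
            ((Fintype.card V * Fintype.card V : ℕ) : ℝ) := Nat.cast_le.2 (Nat.sub_le _ _)
          push_cast at this ⊢
          rw [sq]
          exact this
  have hE2 : ∑ ω, wt p ω * bad2 ω ≤ 1 / 4 := by
    refine le_trans ?_ hB
    simp only [bad2, mul_sum]
    rw [sum_comm]
    calc _ ≤ ∑ S ∈ ({S | t < #S} : Finset (Finset V)), Real.exp (- (p * ((t : ℝ) ^ 2 / 2) * (1 - θ + θ * Real.log θ))) := by
          apply sum_le_sum
          intro S hS
          exact sparse_bad p θ d t h0 h1 hθ hθ1 hLθ hd S (mem_filter.1 hS).2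
      _ ≤ _ := by
          rw [sum_const, nsmul_eq_mul]
          gcongr
          have : #({S | t < #S} : Finset (Finset V)) ≤ 2 ^ Fintype.card V := by
            rw [← Fintype.card_finset]; exact card_le_univ _
          exact_mod_cast this
  have hθN : 0 < (1 - θ) * N := mul_pos (by linarith) hN'
  obtain ⟨ω, hω⟩ : ∃ ω, bad1 ω / ((1 - θ) * N) + bad2 ω < 1 := by
    by_contra! hcon
    have h2 : ∑ ω : Finset (Sym2 V), wt p ω ≤
        ∑ ω, wt p ω * (bad1 ω / ((1 - θ) * N) + bad2 ω) := by
      apply sum_le_sum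
      intro ω _
      exact le_mul_of_one_le_right (wt_nonneg h0 h1 ω) (hcon ω)
    rw [wt_sum] at h2
    have h3 : ∑ ω, wt p ω * (bad1 ω / ((1 - θ) * N) + bad2 ω) =
        (∑ ω, wt p ω * bad1 ω) / ((1 - θ) * N) + ∑ ω, wt p ω * bad2 ω := by
      rw [sum_div, ← sum_add_distrib]
      apply sum_congr rfl
      intros; ring
    have h4 : (∑ ω, wt p ω * bad1 ω) / ((1 - θ) * N) ≤ 1 / 4 := by
      rw [div_le_iff₀ hθN]; linarith
    linarith
  have hb1 : 0 ≤ bad1 ω := sum_nonneg (fun _ _ => by split_ifs <;> norm_num)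
  have hb2 : 0 ≤ bad2 ω := sum_nonneg (fun _ _ => by split_ifs <;> norm_num)
  have hb1' : bad1 ω < (1 - θ) * N := by
    have : bad1 ω / ((1 - θ) * N) < 1 := by linarith
    rwa [div_lt_one hθN] at this
  have hb2' : bad2 ω < 1 := by
    have : 0 ≤ bad1 ω / ((1 - θ) * N) := by positivity
    linarith
  have hQ : ∀ S : Finset V, t < #S → d * #S ≤ #{e ∈ eds S | e ∈ (Gr ω).edgeSet} := by
    intro S hS
    by_contra hcon
    have : (if Q ω S then (1:ℝ) else 0) ≤ bad2 ω :=
      single_le_sum (f := fun S => if Q ω S then (1:ℝ) else 0)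
        (fun _ _ => by split_ifs <;> norm_num) (mem_filter.2 ⟨mem_univ S, hS⟩)
    rw [if_pos hcon] at this
    linarith
  refine ⟨Gr ω, ?_⟩
  intro W _ hW E hE D hD
  let Bp := {q ∈ (univ : Finset V).offDiag | P ω q}
  let A0 : Finset V := univ \ Bp.image Prod.fst
  have hBp : (#Bp : ℝ) = bad1 ω := by simp [Bp, bad1]
  have hA0 : θ * N < #A0 := by
    have h2 : Fintype.card V ≤ #A0 + #Bp := by
      have := card_image_le (s := Bp) (f := Prod.fst)
      have h3 := le_card_sdiff (Bp.image Prod.fst) univ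
      rw [card_univ] at h3
      have : Fintype.card V - #(Bp.image Prod.fst) ≤ #A0 := h3
      omega
    have h3 : N ≤ (#A0 : ℝ) + #Bp := by rw [hNdef]; exact_mod_cast h2
    linarith
  obtain ⟨f, hf, _, hfE⟩ := embed (Gr ω) D hD A0 c d (by positivity) (m + 1) t (by
      intro u hu v hv huv
      by_contra! hcon
      apply (mem_sdiff.1 hu).2
      rw [mem_image]
      exact ⟨(u, v), mem_filter.2 ⟨by simp [huv], hcon⟩, rfl⟩) le_rfl hQ m le_rfl W inferInstance hW
      E hE A0 (Subset.refl _) (by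
        have : ((m * t : ℕ) : ℝ) < #A0 := by push_cast; linarith
        exact_mod_cast this)
  exact ⟨f, hf, hfE⟩

lemma L_pos (x : ℝ) (hx : 0 < x) (hx1 : x ≠ 1) : 0 < 1 - x + x * Real.log x := by
  have h := Real.log_lt_sub_one_of_pos (inv_pos.2 hx) (by simpa using hx1)
  rw [Real.log_inv] at h
  have h2 : x * (-Real.log x) < x * (x⁻¹ - 1) := mul_lt_mul_of_pos_left h hx
  have h3 : x * (x⁻¹ - 1) = 1 - x := by field_simp
  linarith

set_option maxHeartbeats 2000000 in
lemma asym (x M : ℝ) (hx : 1 < x) (hM : 16 * x ^ 2 / (1 - x + x * Real.log x) < M) :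
    ∃ n0 : ℕ, ∀ n : ℕ, n0 ≤ n → ∃ N : ℕ, (N : ℝ) < M * n ^ 4 * Real.log n ∧
      ∃ G : SimpleGraph (Fin N), RamseyArrowTrees G n := by
  have hL := L_pos x (by linarith) hx.ne'
  set L := 1 - x + x * Real.log x with hLdef
  have hx0 : 0 < x := by linarith
  obtain ⟨M', hM'0, hM'⟩ := _root_.exists_between hM
  have hM'pos : 0 < M' := lt_trans (by positivity) hM'0
  rw [div_lt_iff₀ hL] at hM'0
  obtain ⟨r, hr1, hr2⟩ : ∃ r, 2 / Real.sqrt (L * M') < r ∧ r < 1 / (2 * x) := by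
    apply _root_.exists_between
    have hs : 4 * x < Real.sqrt (L * M') := by
      apply Real.lt_sqrt_of_sq_lt
      nlinarith
    rw [div_lt_div_iff₀ (by linarith) (by linarith)]
    linarith
  have hr0 : 0 < r := lt_of_le_of_lt (by positivity) hr1
  have hβ : 4 < r ^ 2 * L * M' := by
    have hs : 0 < Real.sqrt (L * M') := Real.sqrt_pos.2 (by positivity)
    rw [div_lt_iff₀ hs] at hr1
    have h2 : Real.sqrt (L * M') ^ 2 = L * M' := Real.sq_sqrt (by positivity)
    have h3 : r ^ 2 * L * M' = (r * Real.sqrt (L * M')) ^ 2 := by rw [mul_pow, h2]; ring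
    rw [h3]
    nlinarith
  rw [lt_div_iff₀ (by linarith)] at hr2
  have hr1' : r < 1 := by
    have := mul_pos hr0 (sub_pos.2 hx)
    linarith
  obtain ⟨θ, hθ, hθ1⟩ : ∃ θ, Real.sqrt (2 * x * r) < θ ∧ θ < 1 := by
    apply _root_.exists_between
    rw [Real.sqrt_lt' one_pos]
    linarith
  have hθ0 : 0 < θ := lt_of_le_of_lt (Real.sqrt_nonneg _) hθ
  rw [Real.sqrt_lt' hθ0] at hθ
  have hκ := L_pos θ hθ0 hθ1.ne
  set κ := 1 - θ + θ * Real.log θ with hκdef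
  set γ := r ^ 2 * L * M' - 4 with hγdef
  have hγ : 0 < γ := by linarith
  have hg : 0 < θ ^ 2 / 2 - x * r := by linarith
  set C1 := 2 / (r * (θ ^ 2 / 2 - x * r)) with hC1
  set C2 := 16 / (r * θ ^ 2 * κ) with hC2
  set C3 := 8 * M' * Real.exp (3 * (r ^ 2 * L)) / (γ ^ 2 * (1 - θ)) with hC3
  have hC1p : 0 < C1 := by positivity
  have hC2p : 0 < C2 := by positivity
  have h1θ : 0 < 1 - θ := by linarith
  have hC3p : 0 < C3 := by positivity
  have hθp : 0 < 2 / θ := by positivity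
  have hlog : Filter.Tendsto (fun n : ℕ => Real.log n) Filter.atTop Filter.atTop :=
    Real.tendsto_log_atTop.comp tendsto_natCast_atTop_atTop
  have hev := (hlog.eventually_ge_atTop ((C1 + C2 + 2 / θ + 2 + 1) / M' + C3)).and
    (Filter.eventually_ge_atTop 2)
  obtain ⟨n0, hn0⟩ := Filter.eventually_atTop.1 hev
  refine ⟨n0, fun n hn => ?_⟩
  obtain ⟨hl, hn2⟩ := hn0 n hn
  set ℓ := Real.log n with hℓ
  have hnR : (2 : ℝ) ≤ n := by exact_mod_cast hn2
  have hnpos : (0 : ℝ) < n := by linarith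
  have hn1 : (1 : ℝ) ≤ (n : ℝ) ^ 4 := one_le_pow₀ (by linarith)
  have hn4 : (0 : ℝ) < (n : ℝ) ^ 4 := by positivity
  have hl3 : C3 ≤ ℓ := by
    have : 0 ≤ (C1 + C2 + 2 / θ + 2 + 1) / M' := by positivity
    linarith
  have hlC : C1 + C2 + 2 / θ + 2 ≤ M' * ℓ - 1 := by
    have : (C1 + C2 + 2 / θ + 2 + 1) / M' ≤ ℓ := by linarith
    rw [div_le_iff₀ hM'pos] at this
    linarith
  have hl0 : 0 < ℓ := by linarith
  set N := ⌊M' * n ^ 4 * ℓ⌋₊ with hNdef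
  have hNle : (N : ℝ) ≤ M' * n ^ 4 * ℓ := Nat.floor_le (by positivity)
  have hNge : M' * n ^ 4 * ℓ - 1 < N := Nat.sub_one_lt_floor _
  refine ⟨N, ?_, ?_⟩
  · refine lt_of_le_of_lt hNle ?_
    gcongr
  set Y : ℝ := N / (n : ℝ) ^ 4 with hY
  have hNY : (N : ℝ) = Y * (n : ℝ) ^ 4 := by rw [hY]; field_simp
  have hYge : M' * ℓ - 1 ≤ Y := by
    rw [hY, le_div_iff₀ hn4]
    linarith
  have hY1 : C1 ≤ Y := by linarith
  have hY2 : C2 ≤ Y := by linarith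
  have hY3 : 2 / θ ≤ Y := by linarith
  have hY4 : 2 ≤ Y := by linarith
  have hN2 : (2 : ℝ) ≤ N := by 
    have := mul_le_mul hY4 hn1 zero_le_one (by linarith)
    rw [hNY]; linarith
  have hNpos : (0 : ℝ) < N := lt_of_lt_of_le two_pos hN2
  set t := ⌊θ * N / n⌋₊ with ht
  have htle : (t : ℝ) ≤ θ * N / n := Nat.floor_le (by positivity)
  have htge : θ * N / n - 1 < t := Nat.sub_one_lt_floor _
  have htN : θ * N / n = θ * Y * n ^ 3 := by rw [hNY]; field_simp
  obtain ⟨m, hm⟩ : ∃ m, n = m + 1 := ⟨n - 1, by omega⟩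
  have hp0 : 0 ≤ r / (n : ℝ) ^ 2 := by positivity
  have key := exists_graph (V := Fin N) (r / (n : ℝ) ^ 2) x θ m t hp0
    (by
      rw [div_le_one (by positivity)]
      have : (1 : ℝ) ≤ (n : ℝ) ^ 2 := one_le_pow₀ (by linarith)
      linarith) hx hL.le hθ0 hθ1 hκ.le
    (by rw [Fintype.card_fin]; exact_mod_cast hNpos)
  rw [Fintype.card_fin, ← hm] at key
  apply key
  · -- degree condition
    rw [hC1, div_le_iff₀ (by positivity)] at hY1
    have e1 : (n : ℝ) * (x * (r / (n : ℝ) ^ 2) ^ 2 * N + 1) = n * (x * r ^ 2 * Y + 1) := by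
      rw [hNY]; field_simp
    have e2 : θ * (r / (n : ℝ) ^ 2) * (θ * N / n - 1) / 2 =
        n * (θ ^ 2 * r * Y / 2) - θ * r / (2 * (n : ℝ) ^ 2) := by
      rw [htN]; field_simp
    have e3 : θ * r / (2 * (n : ℝ) ^ 2) ≤ 1 := by
      rw [div_le_one (by positivity)]
      have h5 : (1 : ℝ) ≤ (n : ℝ) ^ 2 := one_le_pow₀ (by linarith)
      have h6 : θ * r ≤ 1 := mul_le_one₀ hθ1.le hr0.le hr1'.le
      linarith
    have e4 : θ * (r / (n : ℝ) ^ 2) * (θ * N / n - 1) / 2 ≤ θ * (r / (n : ℝ) ^ 2) * t / 2 := by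
      gcongr
    refine le_trans ?_ e4
    rw [e1, e2]
    have e5 : n * (x * r ^ 2 * Y + 2) ≤ n * (θ ^ 2 * r * Y / 2) := by
      gcongr
      linarith
    linarith
  · rw [le_div_iff₀ hnpos] at htle
    have : (m : ℝ) ≤ n := by rw [hm]; push_cast; linarith
    have h0 : (0 : ℝ) ≤ t := Nat.cast_nonneg _
    have := mul_le_mul_of_nonneg_right this h0
    linarith
  · -- codegree condition
    have e1 : r ^ 2 * L * M' * ℓ - 3 * (r ^ 2 * L) ≤ (r / (n : ℝ) ^ 2) ^ 2 * ((N : ℝ) - 2) * L := by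
      have e2 : (r / (n : ℝ) ^ 2) ^ 2 * ((N : ℝ) - 2) * L = r ^ 2 * L * (((N : ℝ) - 2) / n ^ 4) := by
        field_simp
      rw [e2]
      have e3 : M' * ℓ - 3 ≤ ((N : ℝ) - 2) / n ^ 4 := by
        rw [le_div_iff₀ hn4]
        linarith
      have e4 : r ^ 2 * L * (M' * ℓ - 3) ≤ r ^ 2 * L * (((N : ℝ) - 2) / n ^ 4) := by gcongr
      linarith
    have e5 : (n : ℝ) ^ 4 = Real.exp (4 * ℓ) := by
      rw [hℓ, show (4 : ℝ) = ((4 : ℕ) : ℝ) by norm_num, Real.exp_nat_mul, Real.exp_log hnpos]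
    have e6 : (N : ℝ) * Real.exp (-((r / (n : ℝ) ^ 2) ^ 2 * ((N : ℝ) - 2) * L)) ≤ (1 - θ) / 4 := by
      calc _ ≤ (M' * n ^ 4 * ℓ) * Real.exp (-(r ^ 2 * L * M' * ℓ - 3 * (r ^ 2 * L))) := by
            gcongr
        _ = M' * Real.exp (3 * (r ^ 2 * L)) * ℓ * Real.exp (-(γ * ℓ)) := by
            have : Real.exp (-(r ^ 2 * L * M' * ℓ - 3 * (r ^ 2 * L))) =
              Real.exp (3 * (r ^ 2 * L)) * Real.exp (-(γ * ℓ)) * Real.exp (-(4 * ℓ)) := by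
              rw [← Real.exp_add, ← Real.exp_add]; congr 1; rw [hγdef]; ring
            rw [this, e5, Real.exp_neg (4 * ℓ)]
            field_simp
        _ ≤ (1 - θ) / 4 := by
            have q := Real.quadratic_le_exp_of_nonneg (x := γ * ℓ) (by positivity)
            have q2 : (γ * ℓ) ^ 2 / 2 ≤ Real.exp (γ * ℓ) := by
              have : 0 < γ * ℓ := by positivity
              linarith
            rw [Real.exp_neg, ← div_eq_mul_inv, div_le_iff₀ (Real.exp_pos _)]
            rw [hC3, div_le_iff₀ (by positivity)] at hl3
            have q3 : (1 - θ) / 4 * ((γ * ℓ) ^ 2 / 2) ≤ (1 - θ) / 4 * Real.exp (γ * ℓ) := by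
              gcongr
            refine le_trans ?_ q3
            have q4 : 8 * M' * Real.exp (3 * (r ^ 2 * L)) * ℓ ≤ ℓ * (γ ^ 2 * (1 - θ)) * ℓ := by
              gcongr
            linarith
    have e7 := mul_le_mul_of_nonneg_left e6 hNpos.le
    calc _ = (N : ℝ) * (N * Real.exp (-((r / (n : ℝ) ^ 2) ^ 2 * ((N : ℝ) - 2) * L))) := by ring
      _ ≤ _ := e7
      _ = _ := by ring
  · -- density condition
    have e1 : (2 : ℝ) ≤ Real.exp 1 := by linarith [Real.add_one_le_exp (1 : ℝ)]
    have e2 : (2 : ℝ) ^ N ≤ Real.exp N := by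
      calc (2 : ℝ) ^ N ≤ (Real.exp 1) ^ N := by gcongr
        _ = _ := by rw [← Real.exp_nat_mul, mul_one]
    have e3 : 2 ≤ θ * N / n := by
      rw [htN]
      rw [div_le_iff₀ hθ0] at hY3
      have : (1 : ℝ) ≤ (n : ℝ) ^ 3 := one_le_pow₀ (by linarith)
      have := mul_le_mul hY3 this zero_le_one (by linarith)
      linarith
    have e4 : θ * N / n / 2 ≤ t := by linarith
    have e5 : 2 * (N : ℝ) ≤ r / (n : ℝ) ^ 2 * ((t : ℝ) ^ 2 / 2) * κ := by
      calc 2 * (N : ℝ) ≤ r / (n : ℝ) ^ 2 * ((θ * N / n / 2) ^ 2 / 2) * κ := by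
            have : r / (n : ℝ) ^ 2 * ((θ * N / n / 2) ^ 2 / 2) * κ =
              N * (Y * (r * θ ^ 2 * κ)) / 8 := by
              rw [hY]; field_simp; norm_num
            rw [this]
            rw [hC2, div_le_iff₀ (by positivity)] at hY2
            have := mul_le_mul_of_nonneg_left hY2 hNpos.le
            linarith
        _ ≤ _ := by gcongr
    calc _ ≤ Real.exp N * Real.exp (-(2 * N)) := by gcongr
      _ = Real.exp (-N) := by rw [← Real.exp_add]; congr 1; ring
      _ ≤ Real.exp (-2) := Real.exp_le_exp.2 (by linarith)
      _ ≤ 1 / 4 := by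
        have : Real.exp (-2) = (Real.exp 1 * Real.exp 1)⁻¹ := by
          rw [← Real.exp_add, ← Real.exp_neg]; norm_num
        rw [this, one_div]
        apply inv_anti₀ (by norm_num)
        have := mul_le_mul e1 e1 zero_le_two (by linarith)
        linarith

end Aux12

theorem stmt12 (K : ℝ)
    (hK : K = sInf {y : ℝ | ∃ x : ℝ, 1 < x ∧ y = 16 * x ^ 2 / (1 - x + x * Real.log x)})
    (ε : ℝ) (hε : 0 < ε) :
    ∃ nε : ℕ, ∀ n : ℕ, nε ≤ n →
      ∃ (V : Type) (_ : Fintype V) (G : SimpleGraph V),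
        ((Fintype.card V : ℝ) < (K + ε) * n ^ 4 * Real.log n) ∧
        RamseyArrowTrees G n := by
  have hne : {y : ℝ | ∃ x : ℝ, 1 < x ∧ y = 16 * x ^ 2 / (1 - x + x * Real.log x)}.Nonempty :=
    ⟨_, 2, by norm_num, rfl⟩
  obtain ⟨y, ⟨x, hx, rfl⟩, hy⟩ := exists_lt_of_csInf_lt hne
    (show sInf {y : ℝ | ∃ x : ℝ, 1 < x ∧ y = 16 * x ^ 2 / (1 - x + x * Real.log x)} < K + ε by
      rw [← hK]; linarith)
  obtain ⟨n0, hn0⟩ := Aux12.asym x (K + ε) hx hy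
  refine ⟨n0, fun n hn => ?_⟩
  obtain ⟨N, hN, G, hG⟩ := hn0 n hn
  exact ⟨Fin N, inferInstance, G, by simpa using hN, hG⟩
end

section
/- There exists n₀ ∈ ℕ such that for every n ≥ n₀ there is a finite simple graph G with fewer than 99·n⁴·ln n vertices such that G → T for every oriented tree T on n vertices. -/
/-- the incidence relation -/
def rr (p : ℕ) (x y : ZMod p × ZMod p) : Prop := x.2 + y.2 = x.1 * y.1

lemma rr_symm {p : ℕ} {x y : ZMod p × ZMod p} (h : rr p x y) : rr p y x := by
  unfold rr at *
  rw [add_comm, h, mul_comm]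

lemma rr_codeg {p : ℕ} [Fact p.Prime] {x y z z' : ZMod p × ZMod p} (hxy : x ≠ y)
    (h1 : rr p x z) (h2 : rr p y z) (h3 : rr p x z') (h4 : rr p y z') : z = z' := by
  unfold rr at *
  have e : (x.1 - y.1) * (z.1 - z'.1) = 0 := by linear_combination h2 - h1 + h3 - h4
  rcases mul_eq_zero.1 e with h | h
  · exfalso
    apply hxy
    have h' : x.1 = y.1 := sub_eq_zero.1 h
    refine Prod.ext h' ?_
    rw [h'] at h1
    linear_combination h1 - h2
  · have h' : z.1 = z'.1 := sub_eq_zero.1 h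
    refine Prod.ext h' ?_
    rw [h'] at h1
    linear_combination h1 - h3

open Classical in
lemma rr_deg {p : ℕ} [Fact p.Prime] (x : ZMod p × ZMod p) :
    (Finset.univ.filter (fun y => rr p x y)).card = p := by
  have : (Finset.univ.filter (fun y => rr p x y))
      = (Finset.univ : Finset (ZMod p)).image (fun c => (c, x.1 * c - x.2)) := by
    ext y
    simp only [Finset.mem_filter, Finset.mem_univ, true_and, Finset.mem_image]
    constructor
    · intro h
      unfold rr at h
      exact ⟨y.1, Prod.ext rfl (by simp only; linear_combination -h)⟩
    · rintro ⟨c, rfl⟩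
      simp only [rr]; ring
  rw [this, Finset.card_image_of_injective, Finset.card_univ, ZMod.card]
  intro a b h
  exact (Prod.ext_iff.1 h).1

/-- the polarity graph -/
def GG (p : ℕ) : SimpleGraph (ZMod p × ZMod p) where
  Adj x y := x ≠ y ∧ rr p x y
  symm := ⟨fun _ _ h => ⟨h.1.symm, rr_symm h.2⟩⟩
  loopless := ⟨fun _ h => h.1 rfl⟩

open Classical in
lemma variance {p : ℕ} [Fact p.Prime] (S : Finset (ZMod p × ZMod p)) :
    ∑ y, (((S.filter (fun x => rr p x y)).card : ℝ) - S.card / p) ^ 2 ≤ S.card * p := by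
  have hp : (0:ℝ) < p := by exact_mod_cast (Fact.out : p.Prime).pos
  have h1 : ∑ y, ((S.filter (fun x => rr p x y)).card : ℝ) = S.card * p := by
    have : ∀ y, ((S.filter (fun x => rr p x y)).card : ℝ)
        = ∑ x ∈ S, if rr p x y then (1:ℝ) else 0 := by
      intro y; simp
    simp_rw [this]
    rw [Finset.sum_comm]
    have : ∀ x ∈ S, ∑ y, (if rr p x y then (1:ℝ) else 0) = p := by
      intro x _
      rw [Finset.sum_boole, rr_deg]
    rw [Finset.sum_congr rfl this]; simp
  have h2 : ∑ y, ((S.filter (fun x => rr p x y)).card : ℝ) ^ 2 ≤ S.card * p + S.card ^ 2 := by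
    have : ∀ y, ((S.filter (fun x => rr p x y)).card : ℝ) ^ 2
        = ∑ x ∈ S, ∑ x' ∈ S, if rr p x y ∧ rr p x' y then (1:ℝ) else 0 := by
      intro y
      have : ((S.filter (fun x => rr p x y)).card : ℝ)
        = ∑ x ∈ S, if rr p x y then (1:ℝ) else 0 := by simp
      rw [this, sq, Finset.sum_mul_sum]
      refine Finset.sum_congr rfl fun x _ => Finset.sum_congr rfl fun x' _ => ?_
      by_cases a : rr p x y <;> by_cases b : rr p x' y <;> simp [a, b]
    simp_rw [this]
    rw [Finset.sum_comm]
    have : ∀ x ∈ S, ∑ y, ∑ x' ∈ S, (if rr p x y ∧ rr p x' y then (1:ℝ) else 0)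
        ≤ p + S.card := by
      intro x hx
      rw [Finset.sum_comm]
      calc _ ≤ ∑ x' ∈ S, ((if x = x' then (p:ℝ) else 0) + 1) := by
            refine Finset.sum_le_sum fun x' _ => ?_
            rw [Finset.sum_boole]
            by_cases h : x = x'
            · subst h
              simp [rr_deg]
            · simp only [h, if_false, zero_add]
              have : (Finset.univ.filter (fun y => rr p x y ∧ rr p x' y)).card ≤ 1 := by
                rw [Finset.card_le_one]
                intro a ha b hb
                simp only [Finset.mem_filter, Finset.mem_univ, true_and] at ha hb
                exact rr_codeg h ha.1 ha.2 hb.1 hb.2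
              exact_mod_cast this
        _ = _ := by
            rw [Finset.sum_add_distrib]
            simp [hx]
    calc _ ≤ ∑ x ∈ S, ((p:ℝ) + S.card) := Finset.sum_le_sum this
      _ = _ := by simp; ring
  have h3 : ∑ y : ZMod p × ZMod p, ((S.card : ℝ) / p) ^ 2 = S.card ^ 2 := by
    simp [ZMod.card]
    field_simp
  have : ∑ y, (((S.filter (fun x => rr p x y)).card : ℝ) - S.card / p) ^ 2
      = ∑ y, ((S.filter (fun x => rr p x y)).card : ℝ) ^ 2
        - 2 * (S.card / p) * ∑ y, ((S.filter (fun x => rr p x y)).card : ℝ)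
        + ∑ y : ZMod p × ZMod p, ((S.card : ℝ) / p) ^ 2 := by
    rw [Finset.mul_sum, ← Finset.sum_sub_distrib, ← Finset.sum_add_distrib]
    exact Finset.sum_congr rfl fun y _ => by ring
  rw [this, h1, h3]
  have : 2 * ((S.card:ℝ) / p) * (S.card * p) = 2 * S.card ^ 2 := by field_simp
  linarith

open Classical in
lemma dense {p n : ℕ} [Fact p.Prime] (hn : 1 ≤ n) (h1 : 16 * n ^ 2 ≤ p) (h2 : p ≤ 32 * n ^ 2)
    (R : ZMod p × ZMod p → ZMod p × ZMod p → Prop) (hR : ∀ u v, (GG p).Adj u v → R u v ∨ R v u)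
    (S : Finset (ZMod p × ZMod p)) (hS : Fintype.card (ZMod p × ZMod p) ≤ n * S.card) :
    ∃ x ∈ S, 2 * n ≤ (S.filter (fun y => R x y)).card := by
  by_contra! hc
  have hp : (0:ℝ) < p := by exact_mod_cast (Fact.out : p.Prime).pos
  have hn' : (1:ℝ) ≤ n := by exact_mod_cast hn
  have hS' : (p:ℝ) * p ≤ n * S.card := by
    simp only [Fintype.card_prod, ZMod.card] at hS
    exact_mod_cast hS
  have hs : (0:ℝ) < S.card := by
    by_contra h
    nlinarith [mul_pos hp hp]
  have h1' : (16:ℝ) * n ^ 2 ≤ p := by exact_mod_cast h1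
  have h2' : (p:ℝ) ≤ 32 * n ^ 2 := by exact_mod_cast h2
  -- degree sum
  have hdeg : ∑ y ∈ S, ((S.filter (fun x => rr p x y)).card : ℝ) ≤ S.card * (4 * n + 1) := by
    have key : ∀ y ∈ S, ((S.filter (fun x => rr p x y)).card : ℝ) ≤
        1 + (S.filter (fun x => R y x)).card + (S.filter (fun x => R x y)).card := by
      intro y _
      have : S.filter (fun x => rr p x y) ⊆
          ({y} ∪ S.filter (fun x => R y x)) ∪ S.filter (fun x => R x y) := by
        intro x hx
        simp only [Finset.mem_filter, Finset.mem_union, Finset.mem_singleton] at hx ⊢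
        by_cases h : x = y
        · exact Or.inl (Or.inl h)
        · rcases hR x y ⟨h, hx.2⟩ with h | h
          · exact Or.inr ⟨hx.1, h⟩
          · exact Or.inl (Or.inr ⟨hx.1, h⟩)
      have a := Finset.card_le_card this
      have b := Finset.card_union_le ({y} ∪ S.filter (fun x => R y x)) (S.filter (fun x => R x y))
      have c := Finset.card_union_le {y} (S.filter (fun x => R y x))
      rw [Finset.card_singleton] at c
      exact_mod_cast (a.trans b).trans (by omega)
    have sw : ∑ y ∈ S, ((S.filter (fun x => R x y)).card : ℝ)
        = ∑ y ∈ S, ((S.filter (fun x => R y x)).card : ℝ) := by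
      have := Finset.sum_card_bipartiteAbove_eq_sum_card_bipartiteBelow (s := S) (t := S) R
      simp only [Finset.bipartiteAbove, Finset.bipartiteBelow] at this
      exact_mod_cast this.symm
    have ub : ∑ y ∈ S, ((S.filter (fun x => R y x)).card : ℝ) ≤ S.card * (2 * n) := by
      rw [← nsmul_eq_mul]
      refine Finset.sum_le_card_nsmul _ _ _ fun y hy => ?_
      exact_mod_cast (hc y hy).le
    have := Finset.sum_le_sum key
    rw [Finset.sum_add_distrib, Finset.sum_add_distrib, sw] at this
    simp only [Finset.sum_const, nsmul_eq_mul, mul_one] at this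
    linarith
  set t : ℝ := S.card / p - (4 * n + 1) with ht
  have hpt : 11 * (n:ℝ) ≤ t := by
    have : (16:ℝ) * n ≤ S.card / p := by
      rw [le_div_iff₀ hp]
      have : n * (16 * (n:ℝ) * p) ≤ n * S.card := by nlinarith
      exact le_of_mul_le_mul_left this (by linarith)
    linarith
  have hv := variance S
  have hv2 : ∑ y ∈ S, (((S.filter (fun x => rr p x y)).card : ℝ) - S.card / p) ^ 2
      ≤ S.card * p := le_trans
        (Finset.sum_le_sum_of_subset_of_nonneg (Finset.subset_univ _) fun _ _ _ => sq_nonneg _) hv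
  have hl : ∑ y ∈ S, (((S.filter (fun x => rr p x y)).card : ℝ) - S.card / p) ≤ - (S.card * t) := by
    rw [Finset.sum_sub_distrib]
    simp only [Finset.sum_const, nsmul_eq_mul]
    rw [ht]; linarith
  have hcs : (∑ y ∈ S, (((S.filter (fun x => rr p x y)).card : ℝ) - S.card / p)) ^ 2
      ≤ S.card * ∑ y ∈ S, (((S.filter (fun x => rr p x y)).card : ℝ) - S.card / p) ^ 2 :=
    sq_sum_le_card_mul_sum_sq
  have ht0 : 0 < t := by linarith
  have : (S.card * t) ^ 2 ≤ S.card * (S.card * p) := by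
    have a : (S.card * t) ^ 2 ≤
        (∑ y ∈ S, (((S.filter (fun x => rr p x y)).card : ℝ) - S.card / p)) ^ 2 := by
      have : 0 < S.card * t := mul_pos hs ht0
      nlinarith
    exact (a.trans hcs).trans (mul_le_mul_of_nonneg_left hv2 hs.le)
  have h3 : t ^ 2 ≤ p := by
    have : (S.card * S.card : ℝ) * t ^ 2 ≤ (S.card * S.card) * p := by nlinarith
    exact le_of_mul_le_mul_left this (mul_pos hs hs)
  nlinarith

open Classical in
lemma embed {V : Type} [Fintype V] [Nonempty V] (G : SimpleGraph V) (n : ℕ)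
    (hcod : ∀ x y z z', x ≠ y → G.Adj x z → G.Adj y z → G.Adj x z' → G.Adj y z' → z = z')
    (hden : ∀ R : V → V → Prop, (∀ u v, G.Adj u v → R u v ∨ R v u) → ∀ S : Finset V,
      Fintype.card V ≤ n * S.card → ∃ x ∈ S, 2 * n ≤ (S.filter (fun y => R x y)).card)
    (D : V → V → Prop) (hD : IsOrientation G D) :
    ∀ m : ℕ, ∀ (W : Type) (_ : Fintype W), Fintype.card W = m + 1 →
      ∀ E : W → W → Prop, IsOrientedTree E → ∀ U : Finset V,
      (m + 1) * Fintype.card V ≤ n * U.card →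
      ∃ f : W → V, Function.Injective f ∧ (∀ u v, E u v ↔ D (f u) (f v)) ∧ ∀ u, f u ∈ U := by
  have hirr : ∀ x, ¬ D x x := fun x h => hD.1 x x ⟨h, h⟩
  have hpos : 0 < Fintype.card V := Fintype.card_pos
  intro m
  induction m with
  | zero =>
    intro W _ hW E hE U hU
    have hne : U.Nonempty := by
      rw [Finset.nonempty_iff_ne_empty]
      rintro rfl
      simp at hU
    obtain ⟨x, hx⟩ := hne
    have : Subsingleton W := Fintype.card_le_one_iff_subsingleton.1 (by omega)
    refine ⟨fun _ => x, Function.injective_of_subsingleton _, fun u v => ?_, fun _ => hx⟩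
    obtain rfl := Subsingleton.elim u v
    exact ⟨fun h => (hE.1 u u ⟨h, h⟩).elim, fun h => (hirr _ h).elim⟩
  | succ m ih =>
    intro W _ hW E hE U hU
    have hmn : m + 2 ≤ n := by
      have : (m + 1 + 1) * Fintype.card V ≤ n * Fintype.card V :=
        hU.trans (Nat.mul_le_mul_left _ (Finset.card_le_univ U))
      exact Nat.le_of_mul_le_mul_right this hpos
    have : Nontrivial W := Fintype.one_lt_card_iff_nontrivial.1 (by omega)
    obtain ⟨w, hw⟩ := hE.2.exists_vert_degree_one_of_nontrivial
    have hconn := hE.2.connected.induce_compl_singleton_of_degree_eq_one hw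
    obtain ⟨u, hu, huniq⟩ := SimpleGraph.degree_eq_one_iff_existsUnique_adj.1 hw
    have huw : u ≠ w := hu.ne'
    have hW' : Fintype.card {x // x ≠ w} = m + 1 := by
      rw [Fintype.card_subtype_compl, Fintype.card_subtype_eq]; omega
    have hE' : IsOrientedTree (fun a b : {x // x ≠ w} => E a b) := by
      refine ⟨fun a b => hE.1 a b, ?_⟩
      have e : SimpleGraph.fromRel (fun a b : {x // x ≠ w} => E a b)
          = (SimpleGraph.fromRel E).induce {w}ᶜ := by
        ext a b
        change _ ↔ (SimpleGraph.fromRel E).Adj a.1 b.1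
        simp [SimpleGraph.fromRel_adj, Subtype.ext_iff]
      rw [e]
      exact ⟨hconn, hE.2.isAcyclic.induce _⟩
    -- direction-independent step
    have step : ∀ R : V → V → Prop, (∀ a b, G.Adj a b ↔ R a b ∨ R b a) →
        ∃ f : {x // x ≠ w} → V, Function.Injective f ∧
          (∀ a b : {x // x ≠ w}, E a b ↔ D (f a) (f b)) ∧ (∀ a, f a ∈ U) ∧
          ∃ y ∈ U, R (f ⟨u, huw⟩) y ∧ (∀ a, y ≠ f a) ∧ ∀ a, a ≠ ⟨u, huw⟩ → ¬ G.Adj (f a) y := by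
      intro R hR
      set U' := U.filter (fun x => 2 * n ≤ (U.filter (fun y => R x y)).card) with hU'
      have hcard : (m + 1) * Fintype.card V ≤ n * U'.card := by
        have hlt : n * (U \ U').card < Fintype.card V := by
          by_contra! hcon
          obtain ⟨x, hx, hx2⟩ := hden R (fun a b h => (hR a b).1 h) (U \ U') hcon
          rw [Finset.mem_sdiff] at hx
          apply hx.2
          rw [hU', Finset.mem_filter]
          exact ⟨hx.1, hx2.trans (Finset.card_le_card
            (Finset.filter_subset_filter _ Finset.sdiff_subset))⟩
        have : (U \ U').card + U'.card = U.card :=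
          Finset.card_sdiff_add_card_eq_card (Finset.filter_subset _ U : U' ⊆ U)
        rw [← this, mul_add] at hU
        nlinarith
      obtain ⟨f, finj, fE, fU⟩ := ih {x // x ≠ w} inferInstance hW' _ hE' U' hcard
      refine ⟨f, finj, fE, fun a => (Finset.mem_filter.1 (fU a)).1, ?_⟩
      set x0 := f ⟨u, huw⟩ with hx0
      set T := U.filter (fun y => R x0 y) with hT
      have hTc : 2 * n ≤ T.card := (Finset.mem_filter.1 (fU ⟨u, huw⟩)).2
      have hTadj : ∀ y ∈ T, G.Adj x0 y := fun y hy =>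
        (hR _ _).2 (Or.inl (Finset.mem_filter.1 hy).2)
      set B := (Finset.univ.erase (⟨u, huw⟩ : {x // x ≠ w})).biUnion
        (fun a => {f a} ∪ T.filter (fun y => G.Adj (f a) y)) with hB
      have hBc : B.card ≤ m * 2 := by
        refine (Finset.card_biUnion_le_card_mul _ _ 2 fun a ha => ?_).trans ?_
        · refine (Finset.card_union_le _ _).trans ?_
          have : (T.filter (fun y => G.Adj (f a) y)).card ≤ 1 := by
            rw [Finset.card_le_one]
            intro y hy z hz
            rw [Finset.mem_filter] at hy hz
            refine hcod x0 (f a) y z ?_ (hTadj _ hy.1) hy.2 (hTadj _ hz.1) hz.2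
            intro h
            exact (Finset.mem_erase.1 ha).1 (finj h).symm
          rw [Finset.card_singleton]
          omega
        · rw [Finset.card_erase_of_mem (Finset.mem_univ _), Finset.card_univ, hW']
          simp
      obtain ⟨y, hyT, hyB⟩ := Finset.exists_mem_notMem_of_card_lt_card (s := B) (t := T) (by omega)
      have hyB' : ∀ a, a ≠ ⟨u, huw⟩ → y ≠ f a ∧ ¬ G.Adj (f a) y := by
        intro a ha
        refine ⟨fun h => hyB ?_, fun h => hyB ?_⟩
        · rw [hB, Finset.mem_biUnion]
          exact ⟨a, Finset.mem_erase.2 ⟨ha, Finset.mem_univ _⟩, by simp [h]⟩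
        · rw [hB, Finset.mem_biUnion]
          exact ⟨a, Finset.mem_erase.2 ⟨ha, Finset.mem_univ _⟩, by simp [h, hyT]⟩
      refine ⟨y, (Finset.mem_filter.1 hyT).1, (Finset.mem_filter.1 hyT).2, fun a => ?_,
        fun a ha => (hyB' a ha).2⟩
      by_cases ha : a = ⟨u, huw⟩
      · rw [ha]; exact (hTadj _ hyT).ne'
      · exact (hyB' a ha).1
    -- gluing
    have glue : ∀ f : {x // x ≠ w} → V, Function.Injective f →
        (∀ a b : {x // x ≠ w}, E a b ↔ D (f a) (f b)) → (∀ a, f a ∈ U) →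
        ∀ y ∈ U, (E u w ↔ D (f ⟨u, huw⟩) y) → (E w u ↔ D y (f ⟨u, huw⟩)) → (∀ a, y ≠ f a) →
        (∀ a, a ≠ ⟨u, huw⟩ → ¬ G.Adj (f a) y) →
        ∃ f : W → V, Function.Injective f ∧ (∀ u v, E u v ↔ D (f u) (f v)) ∧ ∀ u, f u ∈ U := by
      intro f finj fE fU y hy e1 e2 hne hna
      have hEw : ∀ a, a ≠ u → ¬ E a w ∧ ¬ E w a := by
        intro a ha
        constructor
        · intro h
          apply ha
          apply huniq
          rw [SimpleGraph.fromRel_adj]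
          exact ⟨fun e => by subst e; exact hE.1 _ _ ⟨h, h⟩, Or.inr h⟩
        · intro h
          apply ha
          apply huniq
          rw [SimpleGraph.fromRel_adj]
          exact ⟨fun e => by subst e; exact hE.1 _ _ ⟨h, h⟩, Or.inl h⟩
      have c1 : ∀ a (ha : a ≠ w), (E a w ↔ D (f ⟨a, ha⟩) y) := by
        intro a ha
        by_cases hau : a = u
        · subst hau; exact e1
        · refine ⟨fun h => ((hEw a hau).1 h).elim, fun h => ?_⟩
          exact (hna ⟨a, ha⟩ (by simpa using hau) ((hD.2 _ _).2 (Or.inl h))).elim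
      have c2 : ∀ a (ha : a ≠ w), (E w a ↔ D y (f ⟨a, ha⟩)) := by
        intro a ha
        by_cases hau : a = u
        · subst hau; exact e2
        · refine ⟨fun h => ((hEw a hau).2 h).elim, fun h => ?_⟩
          exact (hna ⟨a, ha⟩ (by simpa using hau) ((hD.2 _ _).2 (Or.inr h))).elim
      refine ⟨fun a => if h : a = w then y else f ⟨a, h⟩, ?_, ?_, ?_⟩
      · intro a b hab
        by_cases ha : a = w <;> by_cases hb : b = w
        · rw [ha, hb]
        · simp only [ha, hb, dite_true, dite_false] at hab
          exact (hne _ hab).elim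
        · simp only [ha, hb, dite_true, dite_false] at hab
          exact (hne _ hab.symm).elim
        · simp only [ha, hb, dite_false] at hab
          simpa using finj hab
      · intro a b
        by_cases ha : a = w <;> by_cases hb : b = w
        · subst ha; subst hb
          simp only [dite_true]
          exact ⟨fun h => (hE.1 _ _ ⟨h, h⟩).elim, fun h => (hirr _ h).elim⟩
        · simp only [ha, hb, dite_true, dite_false]
          exact c2 b hb
        · simp only [ha, hb, dite_true, dite_false]
          exact c1 a ha
        · simp only [ha, hb, dite_false]
          exact fE ⟨a, ha⟩ ⟨b, hb⟩
      · intro a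
        by_cases ha : a = w
        · simp only [ha, dite_true]; exact hy
        · simp only [ha, dite_false]; exact fU _
    rw [SimpleGraph.fromRel_adj] at hu
    rcases hu.2 with h | h
    · obtain ⟨f, finj, fE, fU, y, hy, hRy, h1, h2⟩ := step (fun a b => D b a)
        (fun a b => by rw [hD.2, or_comm])
      refine glue f finj fE fU y hy ?_ ?_ h1 h2
      · exact ⟨fun h' => (hE.1 _ _ ⟨h, h'⟩).elim, fun h' => (hD.1 _ _ ⟨h', hRy⟩).elim⟩
      · exact ⟨fun _ => hRy, fun _ => h⟩
    · obtain ⟨f, finj, fE, fU, y, hy, hRy, h1, h2⟩ := step D hD.2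
      refine glue f finj fE fU y hy ?_ ?_ h1 h2
      · exact ⟨fun _ => hRy, fun _ => h⟩
      · exact ⟨fun h' => (hE.1 _ _ ⟨h, h'⟩).elim, fun h' => (hD.1 _ _ ⟨h', hRy⟩).elim⟩

theorem stmt13 :
    ∃ n₀ : ℕ, ∀ n : ℕ, n₀ ≤ n →
      ∃ (V : Type) (_ : Fintype V) (G : SimpleGraph V),
        ((Fintype.card V : ℝ) < 99 * n ^ 4 * Real.log n) ∧
        RamseyArrowTrees G n := by
  refine ⟨⌈Real.exp 11⌉₊, fun n hn => ?_⟩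
  have hexp : Real.exp 11 ≤ n := (Nat.le_ceil _).trans (by exact_mod_cast hn)
  have hnpos : (0:ℝ) < n := lt_of_lt_of_le (Real.exp_pos _) hexp
  have hn1 : 1 ≤ n := by exact_mod_cast hnpos
  have hlog : 11 ≤ Real.log n := (Real.le_log_iff_exp_le hnpos).2 hexp
  obtain ⟨p, hp, hp1, hp2⟩ := Nat.exists_prime_lt_and_le_two_mul (16 * n ^ 2) (by positivity)
  haveI : Fact p.Prime := ⟨hp⟩
  refine ⟨ZMod p × ZMod p, inferInstance, GG p, ?_, ?_⟩
  · simp only [Fintype.card_prod, ZMod.card]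
    push_cast
    have h2 : (p:ℝ) ≤ 32 * n ^ 2 := by
      have : p ≤ 32 * n ^ 2 := by omega
      exact_mod_cast this
    have h4 : (0:ℝ) < n ^ 4 := by positivity
    calc (p:ℝ) * p ≤ (32 * n ^ 2) * (32 * n ^ 2) := by gcongr
      _ = 1024 * n ^ 4 := by ring
      _ < 99 * n ^ 4 * 11 := by linarith
      _ ≤ _ := by gcongr
  · intro W _ hW E hE D hD
    obtain ⟨m, rfl⟩ : ∃ m, n = m + 1 := ⟨n - 1, by omega⟩
    obtain ⟨f, h1, h2, _⟩ := embed (GG p) (m + 1)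
      (fun x y z z' h a b c d => rr_codeg h a.2 b.2 c.2 d.2)
      (fun R hR S hS => dense hn1 hp1.le (by omega) R hR S hS) D hD m W inferInstance hW E hE
      Finset.univ (by rw [Finset.card_univ])
    exact ⟨f, h1, h2⟩
end
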